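/- arXiv:2605.21890 — 7 statements merged into one kernel-verified Lean document; each statement's English description precedes it below -/
import Mathlib

section
/- Let k₁, k₂, k₃, k₄ be nonzero reals and ε ∈ ℝ. If u : ℝ → ℝ → ℝ is smooth and satisfies ∂u/∂t(x,t) = k₃·exp(k₄·u(x,t)) + (1/x)·∂/∂x( x · k₁·exp(k₂·u(x,t)) · ∂u/∂x(x,t) ) for all x > 0 and t > 0, then the function v(x,t) := u( exp((k₂−k₄)ε)·x, exp(−2k₄ε)·t ) − 2ε also satisfies the same equation for all x > 0 and t > 0. -/
/-- The generalized Fisher equation in cylindrical coordinates with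
`f(u) = k₃ e^{k₄ u}` and `g(u) = k₁ e^{k₂ u}`, at the point `(x, t)`:
`∂u/∂t = k₃ e^{k₄ u} + (1/x) ∂/∂x ( x k₁ e^{k₂ u} ∂u/∂x )`. -/
def FisherCylExpExp (k₁ k₂ k₃ k₄ : ℝ) (u : ℝ → ℝ → ℝ) (x t : ℝ) : Prop :=
  deriv (fun τ => u x τ) t =
    k₃ * Real.exp (k₄ * u x t) +
      (1 / x) *
        deriv (fun y => y * (k₁ * Real.exp (k₂ * u y t)) * deriv (fun y' => u y' t) y) x

/-- The one-parameter group generated by the infinitesimal symmetry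
`X₂ = (k₄−k₂)x ∂/∂x + 2k₄ t ∂/∂t − 2 ∂/∂u` maps solutions of the generalized
Fisher equation with `f(u) = k₃ e^{k₄u}`, `g(u) = k₁ e^{k₂u}` to solutions. -/
theorem scaling_symmetry_of_fisherCyl_expExp
    (k₁ k₂ k₃ k₄ : ℝ) (hk₁ : k₁ ≠ 0) (hk₂ : k₂ ≠ 0) (hk₃ : k₃ ≠ 0) (hk₄ : k₄ ≠ 0)
    (ε : ℝ) (u : ℝ → ℝ → ℝ) (hu : ContDiff ℝ (⊤ : ℕ∞) (Function.uncurry u))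
    (hsol : ∀ x > (0 : ℝ), ∀ t > (0 : ℝ), FisherCylExpExp k₁ k₂ k₃ k₄ u x t) :
    ∀ x > (0 : ℝ), ∀ t > (0 : ℝ),
      FisherCylExpExp k₁ k₂ k₃ k₄
        (fun x t => u (Real.exp ((k₂ - k₄) * ε) * x) (Real.exp (-2 * k₄ * ε) * t) - 2 * ε)
        x t := by
  intro x hx t ht
  have ha : 0 < Real.exp ((k₂ - k₄) * ε) := Real.exp_pos _
  have hb : 0 < Real.exp (-2 * k₄ * ε) := Real.exp_pos _
  have hab : Real.exp (-2 * k₂ * ε) * (Real.exp ((k₂ - k₄) * ε)) ^ 2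
      = Real.exp (-2 * k₄ * ε) := by
    rw [← Real.exp_nat_mul, ← Real.exp_add]
    congr 1
    push_cast
    ring
  have h4 : ∀ w : ℝ, Real.exp (k₄ * (w - 2 * ε))
      = Real.exp (-2 * k₄ * ε) * Real.exp (k₄ * w) := by
    intro w
    rw [← Real.exp_add]
    congr 1
    ring
  have h2 : ∀ w : ℝ, Real.exp (k₂ * (w - 2 * ε))
      = Real.exp (-2 * k₂ * ε) * Real.exp (k₂ * w) := by
    intro w
    rw [← Real.exp_add]
    congr 1
    ring
  generalize Real.exp ((k₂ - k₄) * ε) = a at *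
  generalize Real.exp (-2 * k₄ * ε) = b at *
  generalize Real.exp (-2 * k₂ * ε) = c at *
  have key := hsol (a * x) (mul_pos ha hx) (b * t) (mul_pos hb ht)
  unfold FisherCylExpExp at key ⊢
  have e1 : deriv (fun τ => u (a * x) (b * τ) - 2 * ε) t
      = b * deriv (fun τ => u (a * x) τ) (b * t) := by
    rw [deriv_sub_const]
    exact deriv_comp_mul_left b (fun τ => u (a * x) τ) t
  have e2 : ∀ y, deriv (fun y' => u (a * y') (b * t) - 2 * ε) y
      = a * deriv (fun y' => u y' (b * t)) (a * y) := by
    intro y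
    rw [deriv_sub_const]
    exact deriv_comp_mul_left a (fun y' => u y' (b * t)) y
  simp only [e1, e2, h4, h2]
  rw [key]
  set F : ℝ → ℝ := fun y => y * (k₁ * Real.exp (k₂ * u y (b * t))) *
    deriv (fun y' => u y' (b * t)) y with hF
  have e3 : (fun y => y * (k₁ * (c * Real.exp (k₂ * u (a * y) (b * t)))) *
      (a * deriv (fun y' => u y' (b * t)) (a * y))) = fun y => c * F (a * y) := by
    funext y
    simp only [hF]
    ring
  have e4 : deriv (fun y => c * F (a * y)) x = c * (a * deriv F (a * x)) := by
    rw [deriv_const_mul_field]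
    congr 1
    exact deriv_comp_mul_left a F x
  rw [e3, e4, ← hab]
  field_simp
end

section
/- Let k₁, k₂, k₅ be nonzero reals and ε ∈ ℝ. If u : ℝ → ℝ → ℝ is smooth and satisfies ∂u/∂t(x,t) = k₅ + (1/x)·∂/∂x( x · k₁·exp(k₂·u(x,t)) · ∂u/∂x(x,t) ) for all x > 0 and all t ∈ ℝ, then the function v(x,t) := u( exp(−k₂ε)·x, t ) + 2ε also satisfies the same equation for all x > 0 and all t ∈ ℝ. -/
/-- The generalized Fisher equation in cylindrical coordinates with constant
source `f(u) = k₅` and diffusion `g(u) = k₁ e^{k₂ u}`, at the point `(x, t)`: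
`∂u/∂t = k₅ + (1/x) ∂/∂x ( x k₁ e^{k₂ u} ∂u/∂x )`. -/
def FisherCylExpConst (k₁ k₂ k₅ : ℝ) (u : ℝ → ℝ → ℝ) (x t : ℝ) : Prop :=
  deriv (fun τ => u x τ) t =
    k₅ +
      (1 / x) *
        deriv (fun y => y * (k₁ * Real.exp (k₂ * u y t)) * deriv (fun y' => u y' t) y) x

/-- The one-parameter group generated by the infinitesimal symmetry
`X₃ = k₂ x ∂/∂x + 2 ∂/∂u` maps solutions of the generalized Fisher equation
with `f(u) = k₅`, `g(u) = k₁ e^{k₂u}` to solutions. -/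
theorem scaling_symmetry_of_fisherCyl_expConst
    (k₁ k₂ k₅ : ℝ) (hk₁ : k₁ ≠ 0) (hk₂ : k₂ ≠ 0) (hk₅ : k₅ ≠ 0)
    (ε : ℝ) (u : ℝ → ℝ → ℝ) (hu : ContDiff ℝ (⊤ : ℕ∞) (Function.uncurry u))
    (hsol : ∀ x > (0 : ℝ), ∀ t : ℝ, FisherCylExpConst k₁ k₂ k₅ u x t) :
    ∀ x > (0 : ℝ), ∀ t : ℝ,
      FisherCylExpConst k₁ k₂ k₅
        (fun x t => u (Real.exp (-k₂ * ε) * x) t + 2 * ε) x t := by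
  intro x hx t
  have ha : 0 < Real.exp (-k₂ * ε) := Real.exp_pos _
  have hE : Real.exp (k₂ * (2 * ε)) = (Real.exp (-k₂ * ε) ^ 2)⁻¹ := by
    rw [← Real.exp_nat_mul, ← Real.exp_neg]
    congr 1
    push_cast
    ring
  have h := hsol (Real.exp (-k₂ * ε) * x) (mul_pos ha hx) t
  unfold FisherCylExpConst at h ⊢
  generalize Real.exp (-k₂ * ε) = a at *
  have hd : ∀ y, deriv (fun y' => u (a * y') t + 2 * ε) y
      = a * deriv (fun y' => u y' t) (a * y) := by
    intro y
    rw [deriv_add_const]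
    simpa using deriv_comp_mul_left a (fun y' => u y' t) y
  have hF : (fun y => y * (k₁ * Real.exp (k₂ * (u (a * y) t + 2 * ε)))
        * deriv (fun y' => u (a * y') t + 2 * ε) y)
      = fun y => (a ^ 2)⁻¹ * (fun z => z * (k₁ * Real.exp (k₂ * u z t))
        * deriv (fun y' => u y' t) z) (a * y) := by
    funext y
    rw [hd, mul_add, Real.exp_add, hE]
    ring
  have hG := deriv_comp_mul_left a (fun z => z * (k₁ * Real.exp (k₂ * u z t))
        * deriv (fun y' => u y' t) z) x
  rw [hF, deriv_const_mul_field, hG, deriv_add_const, h, smul_eq_mul]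
  generalize deriv (fun z => z * (k₁ * Real.exp (k₂ * u z t))
        * deriv (fun y' => u y' t) z) (a * x) = D
  field_simp
end

section
/- Let k₁, k₂, k₃, k₄ be nonzero reals and let h : ℝ → ℝ be smooth with h(z) > 0 for all z > 0. Define u(x,t) := (1/k₂)·log h( x²·t^{k₂/k₄ − 1} ) − (1/k₄)·log t for x > 0, t > 0. Then u satisfies ∂u/∂t(x,t) = k₃·exp(k₄·u(x,t)) + (1/x)·∂/∂x( x·k₁·exp(k₂·u(x,t))·∂u/∂x(x,t) ) for all x > 0 and t > 0 if and only if h satisfies the similarity-reduced ordinary differential equation 4k₁k₄·z·h''(z) + ( 4k₁k₄ + (k₄−k₂)·z/h(z) )·h'(z) + k₂k₃k₄·h(z)^{k₄/k₂} + k₂ = 0 for all z > 0. -/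
/-- Pointwise equivalence of the PDE at `(x,t)` and the reduced equation at `z = x² t^a`. -/
theorem fisher_pointwise
    (k₁ k₂ k₃ k₄ : ℝ) (hk₂ : k₂ ≠ 0) (hk₄ : k₄ ≠ 0)
    (h : ℝ → ℝ) (hh : ContDiff ℝ (⊤ : ℕ∞) h) (hpos : ∀ z > (0 : ℝ), 0 < h z)
    (u : ℝ → ℝ → ℝ)
    (hu : ∀ x t : ℝ,
      u x t = (1 / k₂) * Real.log (h (x ^ 2 * t ^ (k₂ / k₄ - 1))) -
        (1 / k₄) * Real.log t) (x t z : ℝ) (hx : 0 < x) (ht : 0 < t)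
    (hz : x ^ 2 * t ^ (k₂ / k₄ - 1) = z) :
    FisherCylExpExp k₁ k₂ k₃ k₄ u x t ↔
        4 * k₁ * k₄ * z * deriv (deriv h) z +
          (4 * k₁ * k₄ + (k₄ - k₂) * z / h z) * deriv h z +
          k₂ * k₃ * k₄ * h z ^ (k₄ / k₂) + k₂ = 0 := by
  have hd1 : ∀ y, HasDerivAt h (deriv h y) y := fun y =>
    ((hh.differentiable (by simp)) y).hasDerivAt
  have hd2 : ∀ y, HasDerivAt (deriv h) (deriv (deriv h) y) y := fun y =>
    (((contDiff_infty_iff_deriv.1 hh).2.differentiable (by simp)) y).hasDerivAt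
  have hzpos : 0 < z := by rw [← hz]; positivity
  have hhz := hpos z hzpos
  -- time derivative
  have e1 : deriv (fun τ => u x τ) t =
      (1 / k₂) * (deriv h z * ((k₂ / k₄ - 1) * z / t) / h z) - (1 / k₄) * (1 / t) := by
    have h0 : HasDerivAt (fun τ : ℝ => x ^ 2 * τ ^ (k₂ / k₄ - 1))
        ((k₂ / k₄ - 1) * z / t) t := by
      have := (Real.hasDerivAt_rpow_const (x := t) (p := k₂ / k₄ - 1) (Or.inl ht.ne')).const_mul
        (x ^ 2)
      refine this.congr_deriv ?_
      rw [← hz, Real.rpow_sub_one ht.ne' (k₂ / k₄ - 1)]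
      ring
    have h1 := (hd1 (x ^ 2 * t ^ (k₂ / k₄ - 1))).comp t h0
    have h2 := h1.log (by simp only [Function.comp_apply]; rw [hz]; exact hhz.ne')
    have h3 := (h2.const_mul (1 / k₂)).sub ((Real.hasDerivAt_log ht.ne').const_mul (1 / k₄))
    have h4 : (fun τ => u x τ) = fun τ => (1 / k₂) *
        Real.log (h (x ^ 2 * τ ^ (k₂ / k₄ - 1))) - (1 / k₄) * Real.log τ := by
      funext τ; exact hu x τ
    rw [h4]
    refine Eq.trans (HasDerivAt.deriv h3) ?_
    simp only [Function.comp_apply, hz, one_div]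
  have e2 : Real.exp (k₄ * u x t) = h z ^ (k₄ / k₂) / t := by
    rw [hu, hz, Real.rpow_def_of_pos hhz]
    nth_rewrite 2 [← Real.exp_log ht]
    rw [← Real.exp_sub]
    congr 1
    field_simp
  have e3 : ∀ y > 0, y * (k₁ * Real.exp (k₂ * u y t)) * deriv (fun y' => u y' t) y =
      2 * k₁ / (k₂ * t) * (y ^ 2 * deriv h (y ^ 2 * t ^ (k₂ / k₄ - 1))) := by
    intro y hy
    have hwp : 0 < h (y ^ 2 * t ^ (k₂ / k₄ - 1)) := hpos _ (by positivity)
    have h0 : HasDerivAt (fun y : ℝ => y ^ 2 * t ^ (k₂ / k₄ - 1))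
        (2 * y * t ^ (k₂ / k₄ - 1)) y := by
      simpa using (hasDerivAt_pow 2 y).mul_const (t ^ (k₂ / k₄ - 1))
    have h1 := (hd1 (y ^ 2 * t ^ (k₂ / k₄ - 1))).comp y h0
    have h2 := h1.log (by simpa using hwp.ne')
    have h3 := (h2.const_mul (1 / k₂)).sub_const ((1 / k₄) * Real.log t)
    have h4 : (fun y' => u y' t) = fun y' => (1 / k₂) *
        Real.log (h (y' ^ 2 * t ^ (k₂ / k₄ - 1))) - (1 / k₄) * Real.log t := by
      funext τ; exact hu τ t
    have h5 : deriv (fun y' => u y' t) y = (1 / k₂) *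
        (deriv h (y ^ 2 * t ^ (k₂ / k₄ - 1)) * (2 * y * t ^ (k₂ / k₄ - 1)) /
          h (y ^ 2 * t ^ (k₂ / k₄ - 1))) := by
      rw [h4]; exact HasDerivAt.deriv h3
    have h6 : Real.exp (k₂ * u y t) = h (y ^ 2 * t ^ (k₂ / k₄ - 1)) / t ^ (k₂ / k₄) := by
      rw [hu, Real.rpow_def_of_pos ht (k₂ / k₄)]
      nth_rewrite 2 [← Real.exp_log hwp]
      rw [← Real.exp_sub]
      congr 1
      field_simp
    rw [h5, h6]
    generalize deriv h (y ^ 2 * t ^ (k₂ / k₄ - 1)) = D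
    generalize h (y ^ 2 * t ^ (k₂ / k₄ - 1)) = H at *
    rw [Real.rpow_sub_one ht.ne']
    have : t ^ (k₂ / k₄) ≠ 0 := (Real.rpow_pos_of_pos ht _).ne'
    generalize t ^ (k₂ / k₄) = T at *
    field_simp
  have e4 : deriv (fun y => y * (k₁ * Real.exp (k₂ * u y t)) * deriv (fun y' => u y' t) y) x =
      2 * k₁ / (k₂ * t) * (2 * x * deriv h z + 2 * x * z * deriv (deriv h) z) := by
    have h0 : HasDerivAt (fun y : ℝ => y ^ 2 * t ^ (k₂ / k₄ - 1))
        (2 * x * t ^ (k₂ / k₄ - 1)) x := by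
      simpa using (hasDerivAt_pow 2 x).mul_const (t ^ (k₂ / k₄ - 1))
    have h1 := (hd2 (x ^ 2 * t ^ (k₂ / k₄ - 1))).comp x h0
    have h2 := ((hasDerivAt_pow 2 x).mul h1).const_mul (2 * k₁ / (k₂ * t))
    have h3 : (fun y => y * (k₁ * Real.exp (k₂ * u y t)) * deriv (fun y' => u y' t) y) =ᶠ[nhds x]
        fun y => 2 * k₁ / (k₂ * t) * (y ^ 2 * deriv h (y ^ 2 * t ^ (k₂ / k₄ - 1))) := by
      filter_upwards [lt_mem_nhds hx] with y hy using e3 y hy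
    rw [h3.deriv_eq]
    refine Eq.trans (HasDerivAt.deriv h2) ?_
    simp only [Function.comp_apply, hz]
    rw [← hz]
    push_cast
    ring
  unfold FisherCylExpExp
  rw [e1, e2, e4]
  generalize h z ^ (k₄ / k₂) = P
  generalize deriv (deriv h) z = D2
  generalize deriv h z = D1
  generalize h z = H at *
  have key : (1 / k₂) * (D1 * ((k₂ / k₄ - 1) * z / t) / H) - (1 / k₄) * (1 / t) -
      (k₃ * (P / t) + 1 / x * (2 * k₁ / (k₂ * t) * (2 * x * D1 + 2 * x * z * D2))) =
      -(4 * k₁ * k₄ * z * D2 + (4 * k₁ * k₄ + (k₄ - k₂) * z / H) * D1 +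
          k₂ * k₃ * k₄ * P + k₂) / (k₂ * k₄ * t) := by
    field_simp
    ring
  rw [← sub_eq_zero, key, div_eq_zero_iff, neg_eq_zero]
  have : k₂ * k₄ * t ≠ 0 := by positivity
  simp [this]

/-- The similarity ansatz `u(x,t) = (1/k₂) log h(x² t^{k₂/k₄ − 1}) − (1/k₄) log t`
solves the generalized Fisher equation with `f(u) = k₃ e^{k₄u}`, `g(u) = k₁ e^{k₂u}`
iff `h` solves the reduced ODE
`4k₁k₄ z h'' + (4k₁k₄ + (k₄−k₂) z / h) h' + k₂k₃k₄ h^{k₄/k₂} + k₂ = 0` on `z > 0`. -/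
theorem similarity_reduction_caseA
    (k₁ k₂ k₃ k₄ : ℝ) (hk₁ : k₁ ≠ 0) (hk₂ : k₂ ≠ 0) (hk₃ : k₃ ≠ 0) (hk₄ : k₄ ≠ 0)
    (h : ℝ → ℝ) (hh : ContDiff ℝ (⊤ : ℕ∞) h) (hpos : ∀ z > (0 : ℝ), 0 < h z)
    (u : ℝ → ℝ → ℝ)
    (hu : ∀ x t : ℝ,
      u x t = (1 / k₂) * Real.log (h (x ^ 2 * t ^ (k₂ / k₄ - 1))) -
        (1 / k₄) * Real.log t) :
    (∀ x > (0 : ℝ), ∀ t > (0 : ℝ), FisherCylExpExp k₁ k₂ k₃ k₄ u x t) ↔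
      (∀ z > (0 : ℝ),
        4 * k₁ * k₄ * z * deriv (deriv h) z +
          (4 * k₁ * k₄ + (k₄ - k₂) * z / h z) * deriv h z +
          k₂ * k₃ * k₄ * h z ^ (k₄ / k₂) + k₂ = 0) := by
  constructor
  · intro H z hz
    have h1 := H (Real.sqrt z) (Real.sqrt_pos.2 hz) 1 one_pos
    exact (fisher_pointwise k₁ k₂ k₃ k₄ hk₂ hk₄ h hh hpos u hu (Real.sqrt z) 1 z
      (Real.sqrt_pos.2 hz) one_pos (by rw [Real.one_rpow, mul_one, Real.sq_sqrt hz.le])).1 h1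
  · intro H x hx t ht
    exact (fisher_pointwise k₁ k₂ k₃ k₄ hk₂ hk₄ h hh hpos u hu x t _ hx ht rfl).2
      (H _ (by positivity))
end

section
/- Let k₁, k₂, k₃, k₅ be nonzero reals and let p : ℝ → ℝ be smooth with p(x) > 0 for all x > 0. Define u(x,t) := k₅·t + (1/k₂)·log p(x) for x > 0, t ∈ ℝ. Then u satisfies ∂u/∂t(x,t) = k₃·exp(k₂·u(x,t)) + k₅ + (1/x)·∂/∂x( x·k₁·exp(k₂·u(x,t))·∂u/∂x(x,t) ) for all x > 0 and all t ∈ ℝ if and only if p satisfies the similarity-reduced ordinary differential equation k₁·x·p''(x) + k₁·p'(x) + k₂·k₃·x·p(x) = 0 for all x > 0. -/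
/-- The generalized Fisher equation in cylindrical coordinates with
`f(u) = k₃ e^{k₂ u} + k₅` and `g(u) = k₁ e^{k₂ u}`, at the point `(x, t)`:
`∂u/∂t = k₃ e^{k₂ u} + k₅ + (1/x) ∂/∂x ( x k₁ e^{k₂ u} ∂u/∂x )`. -/
def FisherCylExpShift (k₁ k₂ k₃ k₅ : ℝ) (u : ℝ → ℝ → ℝ) (x t : ℝ) : Prop :=
  deriv (fun τ => u x τ) t =
    k₃ * Real.exp (k₂ * u x t) + k₅ +
      (1 / x) *
        deriv (fun y => y * (k₁ * Real.exp (k₂ * u y t)) * deriv (fun y' => u y' t) y) x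

/-- The similarity ansatz `u(x,t) = k₅ t + (1/k₂) log p(x)` solves the generalized
Fisher equation with `f(u) = k₃ e^{k₂u} + k₅`, `g(u) = k₁ e^{k₂u}` iff `p` solves
the reduced ODE `k₁ x p'' + k₁ p' + k₂ k₃ x p = 0` on `x > 0`. -/
theorem similarity_reduction_caseB
    (k₁ k₂ k₃ k₅ : ℝ) (hk₁ : k₁ ≠ 0) (hk₂ : k₂ ≠ 0) (hk₃ : k₃ ≠ 0) (hk₅ : k₅ ≠ 0)
    (p : ℝ → ℝ) (hp : ContDiff ℝ (⊤ : ℕ∞) p) (hpos : ∀ x > (0 : ℝ), 0 < p x)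
    (u : ℝ → ℝ → ℝ)
    (hu : ∀ x t : ℝ, u x t = k₅ * t + (1 / k₂) * Real.log (p x)) :
    (∀ x > (0 : ℝ), ∀ t : ℝ, FisherCylExpShift k₁ k₂ k₃ k₅ u x t) ↔
      (∀ x > (0 : ℝ),
        k₁ * x * deriv (deriv p) x + k₁ * deriv p x + k₂ * k₃ * x * p x = 0) := by
  have hd : Differentiable ℝ p := hp.differentiable (by simp)
  have hd2 : Differentiable ℝ (deriv p) := by
    have h2 : ContDiff ℝ 2 p := by exact_mod_cast contDiff_infty.1 hp 2
    exact ((contDiff_succ_iff_deriv (n := 1)).1 h2).2.2.differentiable (by simp)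
  have key : ∀ x > (0 : ℝ), ∀ t : ℝ, FisherCylExpShift k₁ k₂ k₃ k₅ u x t ↔
      k₁ * x * deriv (deriv p) x + k₁ * deriv p x + k₂ * k₃ * x * p x = 0 := by
    intro x hx t
    have hE : ∀ y > (0 : ℝ), Real.exp (k₂ * u y t) = Real.exp (k₂ * (k₅ * t)) * p y := by
      intro y hy
      have h1 : k₂ * u y t = k₂ * (k₅ * t) + Real.log (p y) := by
        rw [hu]; field_simp
      rw [h1, Real.exp_add, Real.exp_log (hpos y hy)]
    have hux : ∀ y > (0 : ℝ), deriv (fun y' => u y' t) y = 1 / k₂ * (deriv p y / p y) := by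
      intro y hy
      have h1 : (fun y' => u y' t) = fun y' => k₅ * t + (1 / k₂) * Real.log (p y') := by
        funext y'; exact hu y' t
      rw [h1]
      exact ((((hd y).hasDerivAt.log (hpos y hy).ne').const_mul (1 / k₂)).const_add _).deriv
    have hut : deriv (fun τ => u x τ) t = k₅ := by
      have h1 : (fun τ => u x τ) = fun τ => k₅ * τ + (1 / k₂) * Real.log (p x) := by
        funext τ; exact hu x τ
      rw [h1]
      have h2 := ((hasDerivAt_id t).const_mul k₅).add_const ((1 / k₂) * Real.log (p x))
      simpa using h2.deriv
    have hflux : deriv (fun y => y * (k₁ * Real.exp (k₂ * u y t)) *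
        deriv (fun y' => u y' t) y) x =
        k₁ * Real.exp (k₂ * (k₅ * t)) / k₂ * (deriv p x + x * deriv (deriv p) x) := by
      have h1 : (fun y => y * (k₁ * Real.exp (k₂ * u y t)) * deriv (fun y' => u y' t) y)
          =ᶠ[nhds x] fun y => k₁ * Real.exp (k₂ * (k₅ * t)) / k₂ * (y * deriv p y) := by
        filter_upwards [lt_mem_nhds hx] with y hy
        rw [hE y hy, hux y hy]
        have := (hpos y hy).ne'
        field_simp
      rw [h1.deriv_eq]
      have h2 := ((hasDerivAt_id x).mul (hd2 x).hasDerivAt).const_mul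
        (k₁ * Real.exp (k₂ * (k₅ * t)) / k₂)
      have h3 := h2.deriv
      simp only [id, one_mul] at h3
      exact h3
    unfold FisherCylExpShift
    rw [hut, hflux, hE x hx]
    have hEpos := (Real.exp_pos (k₂ * (k₅ * t))).ne'
    generalize Real.exp (k₂ * (k₅ * t)) = E at hEpos
    have hx0 := hx.ne'
    have h4 : k₃ * (E * p x) + k₅ +
        1 / x * (k₁ * E / k₂ * (deriv p x + x * deriv (deriv p) x)) = k₅ + E / (x * k₂) *
        (k₁ * x * deriv (deriv p) x + k₁ * deriv p x + k₂ * k₃ * x * p x) := by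
      field_simp
      ring
    rw [h4]
    have h5 : E / (x * k₂) ≠ 0 := div_ne_zero hEpos (mul_ne_zero hx0 hk₂)
    constructor
    · intro h
      have h6 : E / (x * k₂) *
        (k₁ * x * deriv (deriv p) x + k₁ * deriv p x + k₂ * k₃ * x * p x) = 0 := by linarith
      exact (mul_eq_zero.1 h6).resolve_left h5
    · intro h
      rw [h]; simp
  constructor
  · intro h x hx
    exact (key x hx 0).1 (h x hx 0)
  · intro h x hx t
    exact (key x hx t).2 (h x hx)
end

section
/- Let k₁, k₂, k₅ be nonzero reals and c₁ ∈ ℝ, and define p(t) := −4k₁/(k₂k₅) + c₁·exp(−k₂k₅·t). Then the function u(x,t) := (1/k₂)·log( x² / p(t) ) satisfies ∂u/∂t(x,t) = k₅ + (1/x)·∂/∂x( x·k₁·exp(k₂·u(x,t))·∂u/∂x(x,t) ) for all x > 0 and all t with p(t) > 0. -/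
/-- The invariant solution `u(x,t) = (1/k₂) log(x²/p(t))`, with
`p(t) = −4k₁/(k₂k₅) + c₁ e^{−k₂k₅ t}`, solves the generalized Fisher equation
with `f(u) = k₅`, `g(u) = k₁ e^{k₂u}` wherever `x > 0` and `p(t) > 0`. -/
theorem invariant_solution_caseC
    (k₁ k₂ k₅ : ℝ) (hk₁ : k₁ ≠ 0) (hk₂ : k₂ ≠ 0) (hk₅ : k₅ ≠ 0) (c₁ : ℝ)
    (p : ℝ → ℝ)
    (hp : ∀ t : ℝ, p t = -4 * k₁ / (k₂ * k₅) + c₁ * Real.exp (-(k₂ * k₅) * t))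
    (u : ℝ → ℝ → ℝ)
    (hu : ∀ x t : ℝ, u x t = (1 / k₂) * Real.log (x ^ 2 / p t)) :
    ∀ x > (0 : ℝ), ∀ t : ℝ, 0 < p t → FisherCylExpConst k₁ k₂ k₅ u x t := by
  intro x hx t hpt
  unfold FisherCylExpConst
  have hpd : HasDerivAt p (-(k₂ * k₅) * p t - 4 * k₁) t := by
    have h1 : HasDerivAt (fun s : ℝ => -(k₂ * k₅) * s) (-(k₂ * k₅)) t := by
      simpa using (hasDerivAt_id t).const_mul (-(k₂ * k₅))
    have h2 := (h1.exp.const_mul c₁).const_add (-4 * k₁ / (k₂ * k₅))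
    have h3 : p = fun s => -4 * k₁ / (k₂ * k₅) + c₁ * Real.exp (-(k₂ * k₅) * s) := funext hp
    rw [h3]
    refine h2.congr_deriv ?_
    field_simp
    ring
  have hx0 : x ≠ 0 := hx.ne'
  have hp0 : p t ≠ 0 := hpt.ne'
  have ht : HasDerivAt (fun τ => u x τ) (k₅ + 4 * k₁ / (k₂ * p t)) t := by
    have h1 := (((hasDerivAt_const t (x ^ 2)).div hpd hp0).log
      (div_ne_zero (pow_ne_zero 2 hx0) hp0)).const_mul (1 / k₂)
    have h2 : (fun τ => u x τ) = fun τ => (1 / k₂) * Real.log (x ^ 2 / p τ) := funext (hu x)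
    rw [h2]
    refine h1.congr_deriv ?_
    simp only [Pi.div_apply]
    field_simp
    ring
  have hux : ∀ y : ℝ, 0 < y → HasDerivAt (fun y' => u y' t) (2 / (k₂ * y)) y := by
    intro y hy
    have hy0 : y ≠ 0 := hy.ne'
    have h1 := (((hasDerivAt_pow 2 y).div_const (p t)).log
      (div_ne_zero (pow_ne_zero 2 hy0) hp0)).const_mul (1 / k₂)
    have h2 : (fun y' => u y' t) = fun y' => (1 / k₂) * Real.log (y' ^ 2 / p t) :=
      funext (fun y' => hu y' t)
    rw [h2]
    refine h1.congr_deriv ?_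
    field_simp
    norm_num
    ring
  have hflux : (fun y => y * (k₁ * Real.exp (k₂ * u y t)) * deriv (fun y' => u y' t) y)
      =ᶠ[nhds x] fun y => (2 * k₁ / (k₂ * p t)) * y ^ 2 := by
    filter_upwards [lt_mem_nhds hx] with y hy
    have hy0 : y ≠ 0 := ne_of_gt hy
    have he : k₂ * u y t = Real.log (y ^ 2 / p t) := by
      rw [hu]
      field_simp
    rw [(hux y hy).deriv, he, Real.exp_log (div_pos (pow_pos hy 2) hpt)]
    field_simp
  rw [ht.deriv, hflux.deriv_eq, ((hasDerivAt_pow 2 x).const_mul _).deriv]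
  field_simp
  norm_num
  try ring
end

section
/- Let k₁, k₂, k₅ be nonzero reals and c₁, c₂ ∈ ℝ. Then the function u(x,t) := k₅·t + (1/k₂)·log( c₁ + c₂·log x ) satisfies ∂u/∂t(x,t) = k₅ + (1/x)·∂/∂x( x·k₁·exp(k₂·u(x,t))·∂u/∂x(x,t) ) for all t ∈ ℝ and all x > 0 with c₁ + c₂·log x > 0. -/
/-- The invariant solution `u(x,t) = k₅ t + (1/k₂) log(c₁ + c₂ log x)` solves the
generalized Fisher equation with `f(u) = k₅`, `g(u) = k₁ e^{k₂u}` wherever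
`x > 0` and `c₁ + c₂ log x > 0`. -/
theorem invariant_solution_caseC_log
    (k₁ k₂ k₅ : ℝ) (hk₁ : k₁ ≠ 0) (hk₂ : k₂ ≠ 0) (hk₅ : k₅ ≠ 0) (c₁ c₂ : ℝ)
    (u : ℝ → ℝ → ℝ)
    (hu : ∀ x t : ℝ, u x t = k₅ * t + (1 / k₂) * Real.log (c₁ + c₂ * Real.log x)) :
    ∀ t : ℝ, ∀ x > (0 : ℝ), 0 < c₁ + c₂ * Real.log x →
      FisherCylExpConst k₁ k₂ k₅ u x t := by
  intro t x hx hpos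
  unfold FisherCylExpConst
  have h1 : HasDerivAt (fun τ => u x τ) k₅ t := by
    have : (fun τ => u x τ) =
        fun τ => k₅ * τ + (1 / k₂) * Real.log (c₁ + c₂ * Real.log x) := by
      funext τ
      exact hu x τ
    rw [this]
    simpa using ((hasDerivAt_id t).const_mul k₅).add_const
      ((1 / k₂) * Real.log (c₁ + c₂ * Real.log x))
  have hcont : ContinuousAt (fun y => c₁ + c₂ * Real.log y) x :=
    continuousAt_const.add (continuousAt_const.mul (Real.continuousAt_log hx.ne'))
  have h2 : (fun y => y * (k₁ * Real.exp (k₂ * u y t)) * deriv (fun y' => u y' t) y)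
      =ᶠ[nhds x] fun _ => k₁ * Real.exp (k₂ * k₅ * t) * c₂ / k₂ := by
    filter_upwards [lt_mem_nhds hx, hcont.eventually (lt_mem_nhds hpos)] with y hy hp
    have hd : HasDerivAt (fun y' => u y' t)
        ((1 / k₂) * ((c₂ * y⁻¹) / (c₁ + c₂ * Real.log y))) y := by
      have : (fun y' => u y' t) =
          fun y' => k₅ * t + (1 / k₂) * Real.log (c₁ + c₂ * Real.log y') := by
        funext y'
        exact hu y' t
      rw [this]
      exact (((((Real.hasDerivAt_log hy.ne').const_mul c₂).const_add c₁).log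
        hp.ne').const_mul (1 / k₂)).const_add (k₅ * t)
    have he : Real.exp (k₂ * u y t) =
        Real.exp (k₂ * k₅ * t) * (c₁ + c₂ * Real.log y) := by
      rw [hu, show k₂ * (k₅ * t + (1 / k₂) * Real.log (c₁ + c₂ * Real.log y)) =
        k₂ * k₅ * t + Real.log (c₁ + c₂ * Real.log y) by field_simp,
        Real.exp_add, Real.exp_log hp]
    rw [hd.deriv, he]
    have hp' := hp.ne'
    have hy' := hy.ne'
    generalize c₁ + c₂ * Real.log y = p at *
    field_simp
  rw [h1.deriv, h2.deriv_eq]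
  simp
end

section
/- Let k₁, k₂, k₃, k₅ be nonzero reals and ε ∈ ℝ. Suppose u : ℝ → ℝ → ℝ is smooth and satisfies ∂u/∂t(x,t) = k₃·exp(k₂·u(x,t)) + k₅ + (1/x)·∂/∂x( x·k₁·exp(k₂·u(x,t))·∂u/∂x(x,t) ) for all x > 0 and all t ∈ ℝ. For t with exp(k₂k₅t) − k₂k₅ε > 0, set s(t) := (1/(k₂k₅))·log( exp(k₂k₅·t) − k₂k₅·ε ). Then the function v(x,t) := u(x, s(t)) + k₅·(t − s(t)) satisfies the same equation for all x > 0 and all t with exp(k₂k₅t) − k₂k₅ε > 0. -/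
/-- The one-parameter group obtained by exponentiating the infinitesimal symmetry
`X₂ = e^{−k₂k₅t} ∂/∂t + k₅ e^{−k₂k₅t} ∂/∂u` maps solutions of the generalized
Fisher equation with `f(u) = k₃ e^{k₂u} + k₅`, `g(u) = k₁ e^{k₂u}` to solutions. -/
theorem exp_symmetry_of_fisherCyl_expShift
    (k₁ k₂ k₃ k₅ : ℝ) (hk₁ : k₁ ≠ 0) (hk₂ : k₂ ≠ 0) (hk₃ : k₃ ≠ 0) (hk₅ : k₅ ≠ 0)
    (ε : ℝ) (u : ℝ → ℝ → ℝ) (hu : ContDiff ℝ (⊤ : ℕ∞) (Function.uncurry u))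
    (hsol : ∀ x > (0 : ℝ), ∀ t : ℝ, FisherCylExpShift k₁ k₂ k₃ k₅ u x t)
    (s : ℝ → ℝ)
    (hs : ∀ t : ℝ,
      s t = (1 / (k₂ * k₅)) * Real.log (Real.exp (k₂ * k₅ * t) - k₂ * k₅ * ε))
    (v : ℝ → ℝ → ℝ)
    (hv : ∀ x t : ℝ, v x t = u x (s t) + k₅ * (t - s t)) :
    ∀ x > (0 : ℝ), ∀ t : ℝ, 0 < Real.exp (k₂ * k₅ * t) - k₂ * k₅ * ε →
      FisherCylExpShift k₁ k₂ k₃ k₅ v x t := by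
  intro x hx t ht
  have hc : k₂ * k₅ ≠ 0 := mul_ne_zero hk₂ hk₅
  set c := k₂ * k₅ with hcdef
  set r := Real.exp (c * t) / (Real.exp (c * t) - c * ε) with hr
  have hsd : HasDerivAt s r t := by
    have h1 : HasDerivAt (fun τ : ℝ => c * τ) c t := by
      simpa using (hasDerivAt_id t).const_mul c
    have h2 := ((h1.exp.sub_const (c * ε)).log ht.ne').const_mul (1 / c)
    have h3 : s = fun τ => (1 / c) * Real.log (Real.exp (c * τ) - c * ε) := funext hs
    rw [h3]
    refine h2.congr_deriv ?_
    rw [hr]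
    field_simp
  have hes : Real.exp (c * (t - s t)) = r := by
    have h : c * (t - s t) = c * t - Real.log (Real.exp (c * t) - c * ε) := by
      rw [hs t]; field_simp
    rw [h, Real.exp_sub, Real.exp_log ht]
  have hev : ∀ y, Real.exp (k₂ * v y t) = r * Real.exp (k₂ * u y (s t)) := by
    intro y
    rw [← hes, ← Real.exp_add, hv, hcdef]
    congr 1; ring
  have hud : DifferentiableAt ℝ (fun τ => u x τ) (s t) := by
    have h1 : Differentiable ℝ (Function.uncurry u) := hu.differentiable (by simp)
    have h2 : Differentiable ℝ (fun τ : ℝ => Function.uncurry u (x, τ)) :=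
      h1.comp (by fun_prop)
    exact h2 (s t)
  have hvt : deriv (fun τ => v x τ) t
      = deriv (fun τ => u x τ) (s t) * r + k₅ * (1 - r) := by
    have h1 : HasDerivAt (fun τ => u x (s τ)) (deriv (fun τ => u x τ) (s t) * r) t :=
      HasDerivAt.comp t hud.hasDerivAt hsd
    have h2 := h1.add (((hasDerivAt_id t).sub hsd).const_mul k₅)
    have h3 : (fun τ => v x τ) = fun τ => u x (s τ) + k₅ * (τ - s τ) := funext (hv x)
    rw [h3]
    exact h2.deriv
  have hvx : ∀ y, deriv (fun y' => v y' t) y = deriv (fun y' => u y' (s t)) y := by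
    intro y
    simp only [hv, deriv_add_const]
  have hfun : (fun y => y * (k₁ * Real.exp (k₂ * v y t)) * deriv (fun y' => v y' t) y)
      = fun y => r * (y * (k₁ * Real.exp (k₂ * u y (s t))) *
          deriv (fun y' => u y' (s t)) y) := by
    funext y
    rw [hev, hvx]; ring
  have hS := hsol x hx (s t)
  unfold FisherCylExpShift at hS ⊢
  rw [hvt, hfun, deriv_const_mul_field, hS, hev]
  ring
end
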